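/- Translation identities in a raviolo vertex algebra (Lemma 3.2): Let 𝒱 be a raviolo vertex algebra. For every a ∈ 𝒱: (1) Y(a,z)|0⟩ = e^{z∂}a := Σ_{n≥0} (z^n/n!) ∂^n a as elements of 𝒱[[z]]; (2) Y(∂a, z) = ∂_z Y(a,z) as fields on 𝒱; (3) e^{−w∂} Y(a,z) e^{w∂} = Y(a, z−w), i.e. Σ_{j≥0} (w^j/j!) (−ad_∂)^j (Y(a,z)) = Σ_{j≥0} ((−w)^j/j!) ∂_z^j Y(a,z) as elements of End(𝒱) ⊗ 𝒦^{z,w}_dist. -/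

import Mathlib

noncomputable section

variable {V : Type} [AddCommGroup V] [Module ℂ V]

/-- Indicator of `0 ≤ m`, as an integer (the cohomological degree of the monomial of
index `m`: `z`-powers are of degree `0`, the `Ω^m` of degree `1`). -/
def indZ (m : ℤ) : ℤ := if 0 ≤ m then 1 else 0

def sgnZ (m : ℤ) : ℂ := if 0 ≤ m then 1 else -1

/-- The generalized binomial coefficient `C(m, n) = m (m−1) ⋯ (m−n+1) / n!`. -/
def genBinom (m : ℤ) (n : ℕ) : ℂ :=
  (∏ i ∈ Finset.range n, ((m : ℂ) - (i : ℂ))) / (n.factorial : ℂ)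

/-- Validity of combining monomial indices `a`, `b` in one variable: the product of the
corresponding monomials is the monomial of index `a + b + 1` when `okIdx a b` holds, and is
zero otherwise. -/
def okIdx (a b : ℤ) : Prop := (a < 0 ∧ b < 0) ∨ (¬(0 ≤ a ∧ 0 ≤ b) ∧ 0 ≤ a + b + 1)

instance (a b : ℤ) : Decidable (okIdx a b) := by unfold okIdx; infer_instance

/-- A raviolo field on `V`: a family of modes `A m` (`m < 0` the coefficient of `z^{−m−1}`,
`m ≥ 0` the coefficient of `Ω^m_z`) acting finitely on every vector. -/
def IsRavField (A : ℤ → V →ₗ[ℂ] V) : Prop := ∀ v : V, ∃ N : ℤ, ∀ m : ℤ, N ≤ m → A m v = 0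

/-- Homogeneity of a raviolo field of cohomological degree `d` with respect to a grading:
the mode `A m` has degree `d` for `m < 0` and degree `d − 1` for `m ≥ 0`. -/
def IsHomog (gr : ℤ → Submodule ℂ V) (d : ℤ) (A : ℤ → V →ₗ[ℂ] V) : Prop :=
  ∀ (m r : ℤ) (v : V), v ∈ gr r → A m v ∈ gr (r + d + if 0 ≤ m then -1 else 0)

/-- The coefficient of `(1/n!) ∂ⁿ_w Δ(z−w) Cⁿ(w)` at the basis monomial of biindex `(m, k)`
(the mode of `Cⁿ` appearing there is `Cⁿ (k − n + m)`). -/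
def deltaCoef (m : ℤ) (n : ℕ) (k : ℤ) : ℂ :=
  if okIdx ((n : ℤ) - m - 1) (k - (n : ℤ) + m) then sgnZ m * genBinom m n else 0

/-- The identity `[A(z), B(w)] = ∑_{n=0}^{N} (1/n!) ∂ⁿ_w Δ(z−w) Cⁿ(w)` in
`End(V) ⊗ 𝒦^{z,w}_dist`, written out in coefficients (with the Koszul signs coming from
moving modes past monomials). -/
def CommEq (dA dB : ℤ) (A B : ℤ → V →ₗ[ℂ] V) (N : ℕ) (C : ℕ → ℤ → V →ₗ[ℂ] V) : Prop :=
  ∀ (m k : ℤ) (v : V),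
    ((-1 : ℂ) ^ ((dA + indZ m) * indZ k)) • A m (B k v)
      - ((-1 : ℂ) ^ (dA * dB + indZ m * dB)) • B k (A m v)
    = ∑ n ∈ Finset.range (N + 1), deltaCoef m n k • C n (k - (n : ℤ) + m) v

/-- Mutual locality of two homogeneous raviolo fields of degrees `dA`, `dB`: there are
finitely many homogeneous fields `C⁰, …, C^N` with
`[A(z), B(w)] = ∑ₙ (1/n!) ∂ⁿ_w Δ(z−w) Cⁿ(w)`. -/
def MutLocal (gr : ℤ → Submodule ℂ V) (dA dB : ℤ) (A B : ℤ → V →ₗ[ℂ] V) : Prop :=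
  ∃ (N : ℕ) (C : ℕ → ℤ → V →ₗ[ℂ] V) (dC : ℕ → ℤ),
    (∀ n, IsRavField (C n)) ∧ (∀ n, IsHomog gr (dC n) (C n)) ∧ CommEq dA dB A B N C

/-- A raviolo vertex algebra structure on the graded vector space `V` (with grading `gr`),
with vacuum vector `vac`, translation operator `T`, and state-operator correspondence
`Y : a ↦ (a₍ₘ₎)ₘ`:  the state-field axiom, the translation axiom
`[∂, Y(a,z)] = ∂_z Y(a,z)`, the vacuum axiom, and the locality axiom. -/
def IsRVA (gr : ℤ → Submodule ℂ V) (vac : V) (T : V →ₗ[ℂ] V)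
    (Y : V → ℤ → V →ₗ[ℂ] V) : Prop :=
  DirectSum.IsInternal gr ∧
  vac ∈ gr 0 ∧
  (∀ (a b : V) (m : ℤ), Y (a + b) m = Y a m + Y b m) ∧
  (∀ (c : ℂ) (a : V) (m : ℤ), Y (c • a) m = c • Y a m) ∧
  (∀ a : V, IsRavField (Y a)) ∧
  (∀ (d : ℤ) (a : V), a ∈ gr d → IsHomog gr d (Y a)) ∧
  (∀ (d : ℤ) (a : V), a ∈ gr d → T a ∈ gr d) ∧
  (∀ (a v : V) (m : ℤ), T (Y a m v) - Y a m (T v) = (-(m : ℂ)) • Y a (m - 1) v) ∧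
  T vac = 0 ∧
  (∀ (m : ℤ) (v : V), Y vac m v = if m = -1 then v else 0) ∧
  (∀ (a : V) (m : ℤ), 0 ≤ m → Y a m vac = 0) ∧
  (∀ a : V, Y a (-1) vac = a) ∧
  (∀ (dA dB : ℤ) (a b : V), a ∈ gr dA → b ∈ gr dB → MutLocal gr dA dB (Y a) (Y b))

/-- `(−ad_∂)^j` applied modewise to a field: `adIter T A 0 = A` and
`adIter T A (j+1) m = (adIter T A j m) ∘ T − T ∘ (adIter T A j m)`. -/
def adIter (T : V →ₗ[ℂ] V) (A : ℤ → V →ₗ[ℂ] V) : ℕ → ℤ → V →ₗ[ℂ] V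
  | 0 => A
  | j + 1 => fun m => adIter T A j m ∘ₗ T - T ∘ₗ adIter T A j m

theorem genBinom_zero' (m : ℤ) : genBinom m 0 = 1 := by simp [genBinom]

theorem genBinom_absorb (m : ℤ) (n : ℕ) :
    ((n : ℂ) + 1) * genBinom m (n + 1) = (m : ℂ) * genBinom (m - 1) n := by
  have h1 : ((n.factorial : ℕ) : ℂ) ≠ 0 := by exact_mod_cast n.factorial_ne_zero
  have h2 : ((n : ℂ) + 1) ≠ 0 := by exact_mod_cast n.succ_ne_zero
  unfold genBinom
  rw [Finset.prod_range_succ', Nat.factorial_succ]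
  push_cast
  have : ∀ i : ℕ, (m : ℂ) - ((i : ℂ) + 1) = (m : ℂ) - 1 - i := fun i => by ring
  simp only [this]
  field_simp
  simp [mul_comm]

theorem genBinom_pascal (m : ℤ) (n : ℕ) :
    genBinom m (n + 1) - genBinom (m - 1) (n + 1) = genBinom (m - 1) n := by
  have h2 : ((n : ℂ) + 1) ≠ 0 := by exact_mod_cast n.succ_ne_zero
  have h1 : ((n.factorial : ℕ) : ℂ) ≠ 0 := by exact_mod_cast n.factorial_ne_zero
  have ha := genBinom_absorb m n
  have hb : ((n : ℂ) + 1) * genBinom (m - 1) (n + 1)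
      = ((m : ℂ) - 1 - n) * genBinom (m - 1) n := by
    unfold genBinom
    rw [Finset.prod_range_succ, Nat.factorial_succ]
    push_cast
    field_simp
  apply mul_left_cancel₀ h2
  rw [mul_sub, ha, hb]; ring

theorem binom_indep (N : ℕ) : ∀ (M : ℤ) (x : ℕ → V),
    (∀ m : ℤ, m ≤ M → ∑ n ∈ Finset.range N, genBinom m n • x n = 0) →
    ∀ n < N, x n = 0 := by
  induction N with
  | zero => intro M x _ n hn; omega
  | succ N ih =>
    intro M x h
    have hs : ∀ n < N, x (n + 1) = 0 := by
      apply ih (M - 1) (fun n => x (n + 1))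
      intro m hm
      have h1 := h (m + 1) (by omega)
      have h2 := h m (by omega)
      rw [Finset.sum_range_succ', genBinom_zero'] at h1 h2
      have h3 : ∀ n, genBinom m n • x (n + 1)
          = genBinom (m + 1) (n + 1) • x (n + 1) - genBinom m (n + 1) • x (n + 1) := by
        intro n
        have := genBinom_pascal (m + 1) n
        rw [add_sub_cancel_right] at this
        rw [← sub_smul, this]
      simp only [h3, Finset.sum_sub_distrib]
      rw [← sub_eq_zero.mpr (h1.trans h2.symm)]; abel
    intro n hn
    cases n with
    | succ n => exact hs n (by omega)
    | zero =>
      have h1 := h M le_rfl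
      rw [Finset.sum_range_succ', genBinom_zero', Finset.sum_eq_zero] at h1
      · simpa using h1
      · intro i hi
        rw [hs i (Finset.mem_range.mp hi), smul_zero]

theorem CommEq.pad {dA dB : ℤ} {A B : ℤ → V →ₗ[ℂ] V} {N : ℕ} {C : ℕ → ℤ → V →ₗ[ℂ] V}
    (h : CommEq dA dB A B N C) (M : ℕ) (hM : N ≤ M) :
    CommEq dA dB A B M (fun n => if n ≤ N then C n else 0) := by
  intro m k v
  rw [h m k v]
  rw [← Finset.sum_subset (s₁ := Finset.range (N + 1)) (s₂ := Finset.range (M + 1))]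
  · apply Finset.sum_congr rfl
    intro n hn
    have hn' : n ≤ N := by simp only [Finset.mem_range] at hn; omega
    simp only [if_pos hn']
  · intro n; simp only [Finset.mem_range]; omega
  · intro n _ hn
    have hn' : ¬ n ≤ N := by simp only [Finset.mem_range] at hn; omega
    simp [if_neg hn']

theorem CommEq.sub {dA dB : ℤ} {A A' B : ℤ → V →ₗ[ℂ] V} {N : ℕ} {C C' : ℕ → ℤ → V →ₗ[ℂ] V}
    (h : CommEq dA dB A B N C) (h' : CommEq dA dB A' B N C') :
    CommEq dA dB (A - A') B N (C - C') := by
  intro m k v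
  simp only [Pi.sub_apply, LinearMap.sub_apply, map_sub, smul_sub, Finset.sum_sub_distrib]
  rw [← h m k v, ← h' m k v]; abel

theorem CommEq.deriv {dA dB : ℤ} {A B : ℤ → V →ₗ[ℂ] V} {N : ℕ} {C : ℕ → ℤ → V →ₗ[ℂ] V}
    (h : CommEq dA dB A B N C) :
    CommEq dA dB (fun m => (-(m : ℂ)) • A (m - 1)) B (N + 1)
      (fun n => match n with
        | 0 => 0
        | n + 1 => fun k => (-((n : ℂ) + 1)) • C n k) := by
  intro m k v
  rw [Finset.sum_range_succ']
  simp only [LinearMap.smul_apply, map_smul]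
  by_cases hm : m = 0
  · subst hm
    have : ∀ n : ℕ, genBinom 0 (n + 1) = 0 := by
      intro n; simp [genBinom, Finset.prod_range_succ']
    simp [deltaCoef, this]
  · have hi : indZ m = indZ (m - 1) := by unfold indZ; split_ifs <;> omega
    have hsg : sgnZ m = sgnZ (m - 1) := by
      unfold sgnZ; split_ifs <;> first | rfl | omega
    rw [hi, smul_comm _ (-(m : ℂ)), smul_comm _ (-(m : ℂ)), ← smul_sub, h (m - 1) k v,
      Finset.smul_sum]
    simp only [Pi.zero_apply, LinearMap.zero_apply, smul_zero, add_zero]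
    apply Finset.sum_congr rfl
    intro n _
    have e1 : k - ((n + 1 : ℕ) : ℤ) + m = k - n + (m - 1) := by push_cast; ring
    have e2 : ((n + 1 : ℕ) : ℤ) - m - 1 = n - (m - 1) - 1 := by push_cast; ring
    rw [smul_smul, smul_smul, e1]
    congr 1
    unfold deltaCoef
    rw [e1, e2, hsg]
    split_ifs
    · linear_combination sgnZ (m - 1) * genBinom_absorb m n
    · simp

/-- Goddard-type uniqueness. -/
theorem CommEq.uniq {dA dB : ℤ} {D B : ℤ → V →ₗ[ℂ] V} {N : ℕ} {C : ℕ → ℤ → V →ₗ[ℂ] V}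
    (h : CommEq dA dB D B N C) (vac : V) (hD : ∀ m, D m vac = 0)
    (hB : ∀ m, 0 ≤ m → B m vac = 0) (m : ℤ) : D m (B (-1) vac) = 0 := by
  have h0 := h m (-1) vac
  have hk : indZ (-1) = 0 := by simp [indZ]
  rw [hD, hk, mul_zero, zpow_zero, one_smul, map_zero, smul_zero, sub_zero] at h0
  rw [h0]
  apply Finset.sum_eq_zero
  intro n hn
  by_cases hnm : (n : ℤ) = m
  · have key : ∀ r < N + 1, (if n ≤ r then C r ((n : ℤ) - 1 - r) vac else 0) = 0 := by
      apply binom_indep (N + 1) (-1)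
      intro p hp
      have h1 := h p (n - 1 - p) vac
      rw [hD, hB _ (by omega), map_zero, map_zero, smul_zero, smul_zero, sub_zero] at h1
      rw [← neg_eq_zero, ← Finset.sum_neg_distrib]
      refine Eq.trans ?_ h1.symm
      apply Finset.sum_congr rfl
      intro r _
      have e : (n : ℤ) - 1 - p - r + p = n - 1 - r := by ring
      unfold deltaCoef sgnZ
      rw [e, if_neg (show ¬ 0 ≤ p by omega)]
      by_cases hr : n ≤ r
      · rw [if_pos hr, if_pos (by unfold okIdx; omega)]
        simp
      · rw [if_neg hr, if_neg (by unfold okIdx; omega)]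
        simp
    have := key n (Finset.mem_range.mp hn)
    rw [if_pos le_rfl] at this
    have e : (-1 : ℤ) - n + m = n - 1 - n := by omega
    rw [e, this, smul_zero]
  · have : deltaCoef m n (-1) = 0 := by
      unfold deltaCoef
      split_ifs with hok
      · have hlt : 0 ≤ m ∧ m < n := by unfold okIdx at hok; omega
        have : genBinom m n = 0 := by
          unfold genBinom
          rw [Finset.prod_eq_zero (i := m.toNat), zero_div]
          · simp only [Finset.mem_range]; omega
          · have : ((m.toNat : ℤ) : ℂ) = (m : ℂ) := by rw [Int.toNat_of_nonneg hlt.1]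
            rw [← this, Int.cast_natCast, sub_self]
        rw [this, mul_zero]
      · rfl
    rw [this, zero_smul]

/-- Translation identities in a raviolo vertex algebra (Lemma 3.2):
(1) `Y(a,z)|0⟩ = e^{z∂} a` in `𝒱[[z]]`;
(2) `Y(∂a, z) = ∂_z Y(a,z)`;
(3) `e^{−w∂} Y(a,z) e^{w∂} = Y(a, z−w)`, i.e. the coefficient of `w^j` in
`Σ_j (w^j/j!) (−ad_∂)^j (Y(a,z))` equals that of `Σ_j ((−w)^j/j!) ∂_z^j Y(a,z)`. -/
theorem raviolo_translation_identities
    (V : Type) [AddCommGroup V] [Module ℂ V]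
    (gr : ℤ → Submodule ℂ V) (vac : V) (T : V →ₗ[ℂ] V) (Y : V → ℤ → V →ₗ[ℂ] V)
    (hV : IsRVA gr vac T Y) :
    (∀ (a : V) (n : ℕ),
        Y a (-(n : ℤ) - 1) vac = ((n.factorial : ℂ))⁻¹ • (⇑T)^[n] a) ∧
    (∀ (a : V) (m : ℤ), 0 ≤ m → Y a m vac = 0) ∧
    (∀ (a : V) (m : ℤ) (v : V), Y (T a) m v = (-(m : ℂ)) • Y a (m - 1) v) ∧
    (∀ (a : V) (m : ℤ) (j : ℕ) (v : V),
        ((j.factorial : ℂ))⁻¹ • adIter T (Y a) j m v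
          = ((∏ i ∈ Finset.range j, ((m : ℂ) - (i : ℂ))) / (j.factorial : ℂ)) •
              Y a (m - (j : ℤ)) v) := by
  obtain ⟨hint, hvac, hadd, hsmul, hfld, hhom, hTgr, hT, hTvac, hYvac, hpos, hm1, hloc⟩ := hV
  have c1 : ∀ (a : V) (n : ℕ),
      Y a (-(n : ℤ) - 1) vac = ((n.factorial : ℂ))⁻¹ • (⇑T)^[n] a := by
    intro a n
    induction n with
    | zero => simp [hm1]
    | succ n ih =>
      have h := hT a vac (-(n : ℤ) - 1)
      rw [hTvac, map_zero, sub_zero, ih, map_smul] at h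
      have h2 : ((n : ℂ) + 1) ≠ 0 := by exact_mod_cast n.succ_ne_zero
      have e : (-((n + 1 : ℕ) : ℤ) - 1) = -(n : ℤ) - 1 - 1 := by push_cast; ring
      have e2 : (-((-(n : ℤ) - 1 : ℤ) : ℂ)) = (n : ℂ) + 1 := by push_cast; ring
      rw [e2] at h
      rw [e, Function.iterate_succ_apply', Nat.factorial_succ, Nat.cast_mul, mul_inv, mul_smul, h]
      push_cast
      rw [inv_smul_smul₀ h2]
  have hind : ∀ (P : V → Prop), (∀ d, ∀ x ∈ gr d, P x) → P 0 →
      (∀ x y, P x → P y → P (x + y)) → ∀ x, P x := by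
    intro P h1 h2 h3 x
    have hx : x ∈ ⨆ i, gr i := by
      rw [hint.submodule_iSup_eq_top]; trivial
    exact Submodule.iSup_induction gr (motive := P) hx h1 h2 h3
  have hY0 : ∀ m, Y 0 m = 0 := by
    intro m
    have := hsmul 0 0 m
    simpa using this
  refine ⟨c1, hpos, ?_, ?_⟩
  · intro a m v
    revert a
    apply hind
    · intro d a ha
      revert v
      apply hind
      · intro e b hb
        obtain ⟨N₁, C₁, _, _, _, h₁⟩ := hloc d e (T a) b (hTgr d a ha) hb
        obtain ⟨N₂, C₂, _, _, _, h₂⟩ := hloc d e a b ha hb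
        have h := (h₁.pad (max N₁ (N₂ + 1)) (le_max_left _ _)).sub
          (h₂.deriv.pad (max N₁ (N₂ + 1)) (le_max_right _ _))
        have hu := h.uniq vac ?_ (hpos b) m
        · rw [hm1] at hu
          exact sub_eq_zero.mp hu
        · intro p
          simp only [Pi.sub_apply, LinearMap.sub_apply, LinearMap.smul_apply]
          rw [sub_eq_zero]
          by_cases hp : 0 ≤ p
          · rw [hpos _ _ hp]
            by_cases hp0 : p = 0
            · simp [hp0]
            · rw [hpos _ _ (by omega), smul_zero]
          · obtain ⟨n, hn⟩ : ∃ n : ℕ, p = -(n : ℤ) - 1 := ⟨(-p - 1).toNat, by omega⟩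
            subst hn
            have h := hT a vac (-(n : ℤ) - 1)
            rw [hTvac, map_zero, sub_zero, c1, map_smul] at h
            rw [← h, c1, ← Function.iterate_succ_apply' T, Function.iterate_succ_apply]
      · simp
      · intro x y hx hy
        rw [map_add, map_add, hx, hy, smul_add]
    · simp [hY0]
    · intro x y hx hy
      rw [map_add, hadd, hadd, LinearMap.add_apply, LinearMap.add_apply, hx, hy, smul_add]
  · intro a m j v
    have key : ∀ (j : ℕ) (v : V), adIter T (Y a) j m v
        = (∏ i ∈ Finset.range j, ((m : ℂ) - (i : ℂ))) • Y a (m - (j : ℤ)) v := by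
      intro j
      induction j with
      | zero => intro v; simp [adIter]
      | succ j ih =>
        intro v
        have h := hT a v (m - j)
        have e : m - ((j + 1 : ℕ) : ℤ) = m - j - 1 := by push_cast; ring
        have h' : Y a (m - j) (T v) - T (Y a (m - j) v) = ((m : ℂ) - j) • Y a (m - j - 1) v := by
          rw [← neg_sub, h, neg_smul, neg_neg]; push_cast; rfl
        simp only [adIter, LinearMap.sub_apply, LinearMap.comp_apply]
        rw [ih, ih, map_smul, ← smul_sub, h', smul_smul, Finset.prod_range_succ, e]
    rw [key, smul_smul, div_eq_inv_mul]
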